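/- arXiv:2505.00048 — 10 statements merged into one kernel-verified Lean document; each statement's English description precedes it below -/
import Mathlib

section
/- Let (X,ρ) be a metric space and f : X → X a CW-expansive map with expansive constant c > 0, and suppose that every open ball in X contains a nondegenerate subcontinuum of X. Then every point x ∈ X is an OE point of X with respect to f with OE constant c/2; in particular, f is an OE map on X. -/
/-- CW-expansive with constant `c`, where every open ball contains a nondegenerate
subcontinuum, implies every point is an OE point with OE constant `c/2`.
"diam (f^[n] '' A) > c" is expressed as the existence of two points of `A` whose
`n`-th images are at distance `> c`. -/
theorem cw_expansive_implies_OE {X : Type*} [MetricSpace X] (f : X → X) (c : ℝ) (hc : 0 < c)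
    (hball : ∀ x : X, ∀ ε > 0, ∃ A : Set X, A ⊆ Metric.ball x ε ∧
      IsCompact A ∧ IsConnected A ∧ A.Nontrivial)
    (hcw : ∀ A : Set X, IsCompact A → IsConnected A → A.Nontrivial →
      ∃ n : ℕ, ∃ u ∈ A, ∃ v ∈ A, c < dist (f^[n] u) (f^[n] v)) :
    ∀ x : X, ∀ ε > 0, ∃ y : X, dist x y < ε ∧ ∃ n : ℕ, c / 2 ≤ dist (f^[n] x) (f^[n] y) := by
  intro x ε hε
  obtain ⟨A, hA, hcomp, hconn, hnt⟩ := hball x ε hε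
  obtain ⟨n, u, hu, v, hv, huv⟩ := hcw A hcomp hconn hnt
  by_contra! h
  have h₁ := h u (Metric.mem_ball'.mp (hA hu)) n
  have h₂ := h v (Metric.mem_ball'.mp (hA hv)) n
  linarith [dist_triangle_left (f^[n] u) (f^[n] v) (f^[n] x)]
end

section
/- Let (X,ρ) be a metric space without isolated points, let A be a dense subset of X, and let f : X → X be expansive on A with expansive constant d_A > 0. Then every point x ∈ X is an OE point of X with respect to f with OE constant d_A/2; in particular, f is an OE map on X. -/
/-- If `A` is dense in `X` (no isolated points) and `f` is expansive on `A` with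
expansive constant `d_A`, then every point of `X` is an OE point of `X` with
OE constant `d_A / 2`. -/
theorem expansive_on_dense_implies_OE {X : Type*} [MetricSpace X] (f : X → X) (A : Set X)
    (dA : ℝ) (hdA : 0 < dA)
    (hni : ∀ x : X, ∀ ε > 0, ∃ y : X, y ≠ x ∧ dist x y < ε)
    (hdense : Dense A)
    (hexp : ∀ x ∈ A, ∀ y ∈ A, x ≠ y → ∃ n : ℕ, dA < dist (f^[n] x) (f^[n] y)) :
    ∀ x : X, ∀ ε > 0, ∃ y : X, dist x y < ε ∧ ∃ n : ℕ, dA / 2 ≤ dist (f^[n] x) (f^[n] y) := by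
  intro x ε hε
  obtain ⟨w, hwx, hw⟩ := hni x ε hε
  obtain ⟨a, haA, ha, hax⟩ := hdense.exists_mem_open
    (Metric.isOpen_ball.inter isOpen_compl_singleton)
    (⟨w, Metric.mem_ball'.2 hw, hwx⟩ : (Metric.ball x ε ∩ {x}ᶜ).Nonempty)
  obtain ⟨b, hbA, hb, hba⟩ := hdense.exists_mem_open
    (Metric.isOpen_ball.inter isOpen_compl_singleton)
    (⟨x, Metric.mem_ball_self hε, Ne.symm hax⟩ : (Metric.ball x ε ∩ {a}ᶜ).Nonempty)
  obtain ⟨n, hn⟩ := hexp a haA b hbA (Ne.symm hba)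
  by_cases h : dA / 2 ≤ dist (f^[n] x) (f^[n] a)
  · exact ⟨a, Metric.mem_ball'.1 ha, n, h⟩
  · refine ⟨b, Metric.mem_ball'.1 hb, n, ?_⟩
    linarith [dist_triangle_left (f^[n] a) (f^[n] b) (f^[n] x)]
end

section
/- Let (X,ρ) be a metric space, f : X → X a map, and A ⊆ X a subset such that every point of A is an OE point of A with respect to f with the same OE constant d_A > 0. If x ∈ X is a limit point of A (every open ball S_ε(x) contains a point of A different from x), then x is an OE point of A with respect to f with OE constant d_A/2. -/
/-- If every point of `A` is an OE point of `A` with OE constant `d_A` and `x`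
is a limit point of `A`, then `x` is an OE point of `A` with OE constant `d_A / 2`. -/
theorem limit_point_is_OE_point {X : Type*} [MetricSpace X] (f : X → X) (A : Set X)
    (dA : ℝ) (hdA : 0 < dA)
    (hOE : ∀ a ∈ A, ∀ ε > 0, ∃ y ∈ A, y ≠ a ∧ dist a y < ε ∧
      ∃ n : ℕ, dA ≤ dist (f^[n] a) (f^[n] y))
    (x : X)
    (hlim : ∀ ε > 0, ∃ y ∈ A, y ≠ x ∧ dist x y < ε) :
    ∀ ε > 0, ∃ y ∈ A, y ≠ x ∧ dist x y < ε ∧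
      ∃ n : ℕ, dA / 2 ≤ dist (f^[n] x) (f^[n] y) := by
  intro ε hε
  obtain ⟨y, hyA, hyx, hy⟩ := hlim (ε / 2) (half_pos hε)
  have hpos : 0 < dist x y := dist_pos.2 hyx.symm
  obtain ⟨z, hzA, -, hz, n, hn⟩ := hOE y hyA (dist x y) hpos
  have hzx : z ≠ x := by
    rintro rfl
    exact hz.ne (dist_comm y z)
  have htri := dist_triangle_left (f^[n] y) (f^[n] z) (f^[n] x)
  by_cases h : dA / 2 ≤ dist (f^[n] x) (f^[n] y)
  · exact ⟨y, hyA, hyx, by linarith, n, h⟩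
  · exact ⟨z, hzA, hzx, by linarith [dist_triangle x y z], n, by linarith⟩
end

section
/- Let (X,ρ) be a metric space, f : X → X a map, and A a dense subset of X such that every point of A is an OE point of A with respect to f with the same OE constant d_A > 0. Then every point of X is an OE point of X with respect to f with OE constant d_A/2; in particular, f is an OE map on X. -/
/-- If `A` is dense in `X` and every point of `A` is an OE point of `A` with OE
constant `d_A`, then every point of `X` is an OE point of `X` with OE constant
`d_A / 2`; in particular `f` is an OE map on `X`. -/
theorem OE_on_dense_implies_OE {X : Type*} [MetricSpace X] (f : X → X) (A : Set X)
    (dA : ℝ) (hdA : 0 < dA)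
    (hdense : Dense A)
    (hOE : ∀ a ∈ A, ∀ ε > 0, ∃ y ∈ A, y ≠ a ∧ dist a y < ε ∧
      ∃ n : ℕ, dA ≤ dist (f^[n] a) (f^[n] y)) :
    ∀ x : X, ∀ ε > 0, ∃ y : X, dist x y < ε ∧
      ∃ n : ℕ, dA / 2 ≤ dist (f^[n] x) (f^[n] y) := by
  intro x ε hε
  obtain ⟨a, ha, hxa⟩ := hdense.exists_dist_lt x (half_pos hε)
  obtain ⟨y, -, -, hay, n, hn⟩ := hOE a ha (ε / 2) (half_pos hε)
  have htri := dist_triangle_left (f^[n] a) (f^[n] y) (f^[n] x)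
  rcases le_or_gt (dA / 2) (dist (f^[n] x) (f^[n] a)) with h | h
  · exact ⟨a, by linarith, n, h⟩
  · exact ⟨y, by linarith [dist_triangle x a y], n, by linarith⟩
end

section
/- Let (X,ρ) be a metric space, f : X → X a map, and A ⊆ X a subset such that every point of A is an OE point of A with respect to f with the same OE constant d_A > 0. Then every point of the closure of A is an OE point of the closure of A with respect to f with OE constant d_A/2; in particular, the closure of A is an OE set with respect to f. -/
/-- If every point of `A` is an OE point of `A` with OE constant `d_A`, then every
point of the closure of `A` is an OE point of the closure of `A` with OE constant
`d_A / 2`; in particular the closure of `A` is an OE set. -/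
theorem closure_of_OE_set_is_OE {X : Type*} [MetricSpace X] (f : X → X) (A : Set X)
    (dA : ℝ) (hdA : 0 < dA)
    (hOE : ∀ a ∈ A, ∀ ε > 0, ∃ y ∈ A, y ≠ a ∧ dist a y < ε ∧
      ∃ n : ℕ, dA ≤ dist (f^[n] a) (f^[n] y)) :
    ∀ x ∈ closure A, ∀ ε > 0, ∃ y ∈ closure A, y ≠ x ∧ dist x y < ε ∧
      ∃ n : ℕ, dA / 2 ≤ dist (f^[n] x) (f^[n] y) := by
  intro x hx ε hε
  obtain ⟨a, ha, hxa⟩ := Metric.mem_closure_iff.1 hx (ε / 2) (half_pos hε)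
  obtain ⟨y, hy, -, hay, n, hn⟩ := hOE a ha (ε / 2) (half_pos hε)
  have ne_of_far : ∀ z, dA / 2 ≤ dist (f^[n] x) (f^[n] z) → z ≠ x := by
    rintro z hz rfl
    rw [dist_self] at hz
    linarith
  rcases le_total (dA / 2) (dist (f^[n] x) (f^[n] a)) with h | h
  · exact ⟨a, subset_closure ha, ne_of_far a h, by linarith, n, h⟩
  · have h' : dA / 2 ≤ dist (f^[n] x) (f^[n] y) := by
      linarith [dist_triangle_left (f^[n] a) (f^[n] y) (f^[n] x)]
    exact ⟨y, subset_closure hy, ne_of_far y h', by linarith [dist_triangle x a y], n, h'⟩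
end

section
/- Let (X,ρ) be a metric space, f : X → X a map, and A₁, …, A_m finitely many subsets of X, each containing at least two points. Then OE(⋃_{i=1}^m A_i) = ⋃_{i=1}^m OE(A_i), where OE(S) denotes the set of all points of X that are OE points of S with respect to f. -/
/-- `x` is an OE point of `A ⊆ X` with respect to `f` if there is an OE constant
`d > 0` such that every ball around `x` contains a point `y ≠ x` of `A` whose orbit
separates from that of `x` by at least `d`. -/
def OEPoints {X : Type*} [MetricSpace X] (f : X → X) (A : Set X) : Set X :=
  {x : X | ∃ d > 0, ∀ ε > 0, ∃ y ∈ A, y ≠ x ∧ dist x y < ε ∧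
    ∃ n : ℕ, d ≤ dist (f^[n] x) (f^[n] y)}

/-- OE points are monotone in the subset. -/
theorem OEPoints_mono {X : Type*} [MetricSpace X] (f : X → X) {A B : Set X} (h : A ⊆ B) :
    OEPoints f A ⊆ OEPoints f B := by
  rintro x ⟨d, hd, hx⟩
  refine ⟨d, hd, fun ε hε ↦ ?_⟩
  obtain ⟨y, hy, hxy⟩ := hx ε hε
  exact ⟨y, h hy, hxy⟩

/-- An OE point of a finite union is an OE point of one of the sets. -/
theorem OEPoints_iUnion_subset {X ι : Type*} [MetricSpace X] [Finite ι] (f : X → X)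
    (A : ι → Set X) : OEPoints f (⋃ i, A i) ⊆ ⋃ i, OEPoints f (A i) := by
  rintro x ⟨d, hd, hx⟩
  by_contra hcon
  have hfar : ∀ i, ∃ ε > 0, ∀ y ∈ A i, y ≠ x → dist x y < ε →
      ∀ n : ℕ, dist (f^[n] x) (f^[n] y) < d := by
    intro i
    by_contra! hi
    exact hcon (Set.mem_iUnion.2 ⟨i, d, hd, hi⟩)
  choose ε hε hfar using hfar
  obtain ⟨δ, hδε, hδ⟩ : ∃ δ, (∀ i, δ < ε i) ∧ 0 < δ :=
    ((Filter.eventually_all.2 fun i ↦ (eventually_lt_nhds (hε i)).filter_mono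
      nhdsWithin_le_nhds).and (self_mem_nhdsWithin (s := Set.Ioi (0 : ℝ)))).exists
  obtain ⟨y, hy, hne, hdist, n, hn⟩ := hx δ hδ
  obtain ⟨i, hi⟩ := Set.mem_iUnion.1 hy
  exact (hfar i y hi hne (hdist.trans (hδε i)) n).not_ge hn

/-- For finitely many subsets, the OE points of the union are exactly the union of
the OE points. -/
theorem OE_finite_union {X : Type*} [MetricSpace X] (f : X → X)
    (m : ℕ) (A : Fin m → Set X) (hA : ∀ i : Fin m, (A i).Nontrivial) :
    OEPoints f (⋃ i : Fin m, A i) = ⋃ i : Fin m, OEPoints f (A i) := by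
  exact (OEPoints_iUnion_subset f A).antisymm
    (Set.iUnion_subset fun i ↦ OEPoints_mono f (Set.subset_iUnion A i))
end

section
/- Let (X,ρ) be a compact metric space, f : X → X a homeomorphism of X onto itself, and m ≥ 1 a natural number. Then f is an OE map on X if and only if f^m (the m-th iterate of f) is an OE map on X. -/
/-- `f` is an OE map on `X` if every point of `X` is an OE point of `X` with some
OE constant. -/
def IsOEMap {X : Type*} [MetricSpace X] (f : X → X) : Prop :=
  ∀ x : X, ∃ d > 0, ∀ ε > 0, ∃ y : X, dist x y < ε ∧
    ∃ n : ℕ, d ≤ dist (f^[n] x) (f^[n] y)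

open scoped Uniformity in
theorem UniformContinuous.exists_forall_iterate_dist_lt {X : Type*} [PseudoMetricSpace X]
    {f : X → X} (hf : UniformContinuous f) (m : ℕ) {d : ℝ} (hd : 0 < d) :
    ∃ δ > 0, ∀ a b : X, dist a b < δ → ∀ r < m, dist (f^[r] a) (f^[r] b) < d := by
  have key : ∀ᶠ p in 𝓤 X, ∀ r ∈ Finset.range m, dist (f^[r] p.1) (f^[r] p.2) < d :=
    (Filter.eventually_all_finset _).2 fun r _ =>
      (hf.iterate f r).eventually (Metric.dist_mem_uniformity hd)
  obtain ⟨δ, hδ, h⟩ := Metric.mem_uniformity_dist.1 key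
  exact ⟨δ, hδ, fun a b hab r hr => h hab r (Finset.mem_range.2 hr)⟩

theorem IsOEMap.iterate {X : Type*} [MetricSpace X] {f : X → X} (hf : UniformContinuous f)
    (h : IsOEMap f) {m : ℕ} (hm : 0 < m) : IsOEMap f^[m] := by
  intro x
  obtain ⟨d, hd, hx⟩ := h x
  obtain ⟨δ, hδ, hδd⟩ := hf.exists_forall_iterate_dist_lt m hd
  refine ⟨δ, hδ, fun ε hε => ?_⟩
  obtain ⟨y, hxy, n, hn⟩ := hx ε hε
  refine ⟨y, hxy, n / m, ?_⟩
  by_contra! hlt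
  have hsmall := hδd _ _ hlt (n % m) (Nat.mod_lt n hm)
  rw [← Function.iterate_mul, ← Function.iterate_add_apply, ← Function.iterate_add_apply,
    Nat.mod_add_div] at hsmall
  exact hsmall.not_ge hn

theorem IsOEMap.of_iterate {X : Type*} [MetricSpace X] {f : X → X} {m : ℕ}
    (h : IsOEMap f^[m]) : IsOEMap f := by
  intro x
  obtain ⟨d, hd, hx⟩ := h x
  refine ⟨d, hd, fun ε hε => ?_⟩
  obtain ⟨y, hxy, n, hn⟩ := hx ε hε
  exact ⟨y, hxy, m * n, by rwa [Function.iterate_mul]⟩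

/-- For a self-homeomorphism `f` of a compact metric space and `m ≥ 1`, `f` is an OE
map on `X` iff `f^m` is an OE map on `X`. -/
theorem OE_iff_iterate_OE {X : Type*} [MetricSpace X] [CompactSpace X]
    (f : X ≃ₜ X) (m : ℕ) (hm : 1 ≤ m) :
    IsOEMap (f : X → X) ↔ IsOEMap ((f : X → X)^[m]) :=
  ⟨fun h => h.iterate (CompactSpace.uniformContinuous_of_continuous f.continuous) hm,
    IsOEMap.of_iterate⟩
end

section
/- Let X be a set equipped with two metrics ρ₁ and ρ₂ that induce the same topology, suppose X is compact in this topology, and let f : X → X be continuous. If f is an OE map on (X,ρ₁), then f is an OE map on (X,ρ₂). -/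
/-- On a compact space, metrics inducing the same topology are uniformly equivalent. -/
theorem exists_dist_lt_of_equivalent_metric {X : Type*} (m₁ m₂ : MetricSpace X)
    (htop : m₁.toUniformSpace.toTopologicalSpace = m₂.toUniformSpace.toTopologicalSpace)
    (hcpt : @CompactSpace X m₁.toUniformSpace.toTopologicalSpace) {ε : ℝ} (hε : 0 < ε) :
    ∃ δ > 0, ∀ x y : X, m₂.dist x y < δ → m₁.dist x y < ε := by
  have hunif : m₁.toUniformSpace = m₂.toUniformSpace :=
    @unique_uniformity_of_compact X m₁.toUniformSpace.toTopologicalSpace hcpt _ _ rfl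
      htop.symm
  have hmem : {p : X × X | m₁.dist p.1 p.2 < ε} ∈ m₁.toUniformSpace.uniformity :=
    @Metric.dist_mem_uniformity X m₁.toPseudoMetricSpace ε hε
  rw [hunif] at hmem
  obtain ⟨δ, hδ, h⟩ := (@Metric.mem_uniformity_dist X m₂.toPseudoMetricSpace _).1 hmem
  exact ⟨δ, hδ, fun x y hxy => @h x y hxy⟩

/-- On a compact space, being an OE map (for a continuous map) does not depend on
the choice of equivalent metrics. -/
theorem OE_independent_of_equivalent_metric {X : Type*} (m₁ m₂ : MetricSpace X)
    (htop : m₁.toUniformSpace.toTopologicalSpace = m₂.toUniformSpace.toTopologicalSpace)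
    (hcpt : @CompactSpace X m₁.toUniformSpace.toTopologicalSpace)
    (f : X → X)
    (hf : @Continuous X X m₁.toUniformSpace.toTopologicalSpace
      m₁.toUniformSpace.toTopologicalSpace f)
    (hOE : ∀ x : X, ∃ d > 0, ∀ ε > 0, ∃ y : X, m₁.dist x y < ε ∧
      ∃ n : ℕ, d ≤ m₁.dist (f^[n] x) (f^[n] y)) :
    ∀ x : X, ∃ d > 0, ∀ ε > 0, ∃ y : X, m₂.dist x y < ε ∧
      ∃ n : ℕ, d ≤ m₂.dist (f^[n] x) (f^[n] y) := by
  intro x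
  obtain ⟨d, hd, hx⟩ := hOE x
  obtain ⟨e, he, hed⟩ := exists_dist_lt_of_equivalent_metric m₁ m₂ htop hcpt hd
  refine ⟨e, he, fun ε hε => ?_⟩
  obtain ⟨δ, hδ, hδε⟩ :=
    exists_dist_lt_of_equivalent_metric m₂ m₁ htop.symm (htop ▸ hcpt) hε
  obtain ⟨y, hxy, n, hn⟩ := hx δ hδ
  exact ⟨y, hδε x y hxy, n, not_lt.1 fun hlt => hn.not_gt (hed _ _ hlt)⟩
end

section
/- Let (X,ρ) be a metric space, f : X → X a map, and A ⊆ X a subset on which f is expansive with expansive constant d_A > 0. If x ∈ X is a limit point of A (every open ball S_ε(x) contains a point of A different from x), then x is a ROE point of A with respect to f, with ε₀ = d_A/2. -/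
/-- If `f` is expansive on `A` with expansive constant `d_A` and `x` is a limit point
of `A`, then `x` is a ROE point of `A` with `ε₀ = d_A / 2`. -/
theorem limit_point_is_ROE_point {X : Type*} [MetricSpace X] (f : X → X) (A : Set X)
    (dA : ℝ) (hdA : 0 < dA)
    (hexp : ∀ x ∈ A, ∀ y ∈ A, x ≠ y → ∃ n : ℕ, dA < dist (f^[n] x) (f^[n] y))
    (x : X)
    (hlim : ∀ ε > 0, ∃ y ∈ A, y ≠ x ∧ dist x y < ε) :
    ∀ ε : ℝ, 0 < ε → ε < dA / 2 → ∃ y ∈ A, y ≠ x ∧ dist x y < ε ∧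
      ∃ n : ℕ, ε ≤ dist (f^[n] x) (f^[n] y) := by
  intro ε hε hεd
  obtain ⟨y, hyA, hyx, hy⟩ := hlim ε hε
  obtain ⟨z, hzA, hzx, hz⟩ := hlim (dist x y) (dist_pos.2 hyx.symm)
  have hyz : y ≠ z := by
    rintro rfl
    exact lt_irrefl _ hz
  obtain ⟨n, hn⟩ := hexp y hyA z hzA hyz
  have htri := dist_triangle_left (f^[n] y) (f^[n] z) (f^[n] x)
  rcases le_total ε (dist (f^[n] x) (f^[n] y)) with h | h
  · exact ⟨y, hyA, hyx, hy, n, h⟩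
  · exact ⟨z, hzA, hzx, hz.trans hy, n, by linarith⟩
end

section
/- Let (X,ρ₁) and (Y,ρ₂) be metric spaces that are OE with respect to the time-varying maps F = {f_n} and G = {g_n} respectively. Equip X × Y with the metric ρ((x₁,y₁),(x₂,y₂)) = max{ρ₁(x₁,x₂), ρ₂(y₁,y₂)}. Then (X × Y, ρ) is OE with respect to the time-varying map F × G = {f_n × g_n}, whose compositions satisfy (F × G)_n(x,y) = (F_n(x), G_n(y)). -/
/-- The compositions of a time-varying map: `F_0 = f_0`, `F_{n+1} = f_{n+1} ∘ F_n`. -/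
def timeVaryingComp {X : Type*} (f : ℕ → X → X) : ℕ → X → X
  | 0 => f 0
  | n + 1 => f (n + 1) ∘ timeVaryingComp f n

theorem timeVaryingComp_prodMap {X Y : Type*} (f : ℕ → X → X) (g : ℕ → Y → Y) (n : ℕ) :
    timeVaryingComp (fun k => Prod.map (f k) (g k)) n =
      Prod.map (timeVaryingComp f n) (timeVaryingComp g n) := by
  induction n with
  | zero => rfl
  | succ n ih => simp only [timeVaryingComp, ih, Prod.map_comp_map]

/-- If `X` and `Y` are OE with respect to the time-varying maps `F = {f_n}` and
`G = {g_n}` respectively, then `X × Y` with the max metric (Mathlib's product metric)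
is OE with respect to the time-varying map `F × G = {f_n × g_n}`. -/
theorem prod_timeVarying_OE {X Y : Type*} [MetricSpace X] [MetricSpace Y]
    (f : ℕ → X → X) (g : ℕ → Y → Y)
    (hf : ∀ x : X, ∃ d > 0, ∀ ε > 0, ∃ x' : X, dist x x' < ε ∧
      ∃ n : ℕ, d ≤ dist (timeVaryingComp f n x) (timeVaryingComp f n x'))
    (hg : ∀ y : Y, ∃ d > 0, ∀ ε > 0, ∃ y' : Y, dist y y' < ε ∧
      ∃ n : ℕ, d ≤ dist (timeVaryingComp g n y) (timeVaryingComp g n y')) :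
    ∀ p : X × Y, ∃ d > 0, ∀ ε > 0, ∃ q : X × Y, dist p q < ε ∧
      ∃ n : ℕ, d ≤ dist (timeVaryingComp (fun k => Prod.map (f k) (g k)) n p)
        (timeVaryingComp (fun k => Prod.map (f k) (g k)) n q) := by
  rintro ⟨x, y⟩
  obtain ⟨d, hd, h⟩ := hf x
  refine ⟨d, hd, fun ε hε => ?_⟩
  obtain ⟨x', hx', n, hn⟩ := h ε hε
  refine ⟨(x', y), ?_, n, ?_⟩
  · rw [Prod.dist_eq]
    simpa using hx'
  · rw [timeVaryingComp_prodMap, Prod.dist_eq]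
    exact hn.trans (le_max_left _ _)
end
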